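/- Let n ≥ 1 and define the Ricci map Ric(t,s) = (2 + 4n t²/s², 4n + 8 − 6t/s) for t,s > 0. Given (t,s) ∈ (0,∞)², there exists a sequence ((t_i,s_i))_{i≤1} of elements of (0,∞)² with (t₁,s₁) = (t,s) and (t_{i−1},s_{i−1}) = Ric(t_i,s_i) for every integer i ≤ 1 if and only if t/s ≤ 1. Moreover, if t/s < 1, then for any such sequence, (t_i,s_i) converges to ((8n²+28n+18)/(2n+3)², (8n²+28n+18)/(2n+3)) as i → −∞. -/

import Mathlib

open Filter Topology

/-- The Ricci map for the `Sp(n+1)Sp(1)`-invariant metrics `g_{t,s}` on `S^{4n+3}`: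
`Ric(t,s) = (2 + 4n t²/s², 4n + 8 − 6t/s)`. -/
noncomputable def RicHP (n : ℕ) (p : ℝ × ℝ) : ℝ × ℝ :=
  (2 + 4 * n * p.1 ^ 2 / p.2 ^ 2, 4 * n + 8 - 6 * p.1 / p.2)

/-- The map induced by `RicHP n` on the ratio `t / s`. -/
noncomputable def ratioMap (n : ℕ) (u : ℝ) : ℝ :=
  (2 + 4 * n * u ^ 2) / (4 * n + 8 - 6 * u)

lemma RicHP_eq (n : ℕ) (p : ℝ × ℝ) :
    RicHP n p = (2 + 4 * n * (p.1 / p.2) ^ 2, 4 * n + 8 - 6 * (p.1 / p.2)) := by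
  simp only [RicHP, div_pow, mul_div_assoc]

lemma RicHP_ratio (n : ℕ) (p : ℝ × ℝ) :
    (RicHP n p).1 / (RicHP n p).2 = ratioMap n (p.1 / p.2) := by
  rw [RicHP_eq, ratioMap]

lemma ratioMap_sub_one {n : ℕ} {u : ℝ} (hd : 0 < 4 * (n : ℝ) + 8 - 6 * u) :
    ratioMap n u - 1 = (u - 1) * (4 * n * u + 4 * n + 6) / (4 * n + 8 - 6 * u) := by
  rw [ratioMap, div_sub_one hd.ne']
  congr 1
  ring

lemma ratioMap_sub_fixedPoint {n : ℕ} {u : ℝ} (hd : 0 < 4 * (n : ℝ) + 8 - 6 * u) :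
    ratioMap n u - 1 / (2 * n + 3) =
      (4 * n * u + 2) / (4 * n + 8 - 6 * u) * (u - 1 / (2 * n + 3)) := by
  have h3 : (0 : ℝ) < 2 * n + 3 := by positivity
  rw [ratioMap, div_mul_eq_mul_div, sub_eq_iff_eq_add, ← sub_eq_iff_eq_add', ← sub_div,
    div_eq_iff hd.ne']
  field_simp
  ring

lemma two_mul_sub_one_le_ratioMap_sub_one {n : ℕ} {u : ℝ}
    (hd : 0 < 4 * (n : ℝ) + 8 - 6 * u) (hu : 1 ≤ u) :
    2 * (u - 1) ≤ ratioMap n u - 1 := by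
  have h0 : (0 : ℝ) ≤ n := n.cast_nonneg
  rw [ratioMap_sub_one hd, le_div_iff₀ hd]
  nlinarith [mul_nonneg (sub_nonneg.2 hu) (mul_nonneg h0 (sub_nonneg.2 hu)),
    mul_nonneg (sub_nonneg.2 hu) (sub_nonneg.2 hu)]

/-- An orbit of the ratio map on which the denominator stays positive starts at most at `1`. -/
lemma orbit_start_le_one {n : ℕ} {y : ℕ → ℝ} (hy : ∀ k, y (k + 1) = ratioMap n (y k))
    (hd : ∀ k, 0 < 4 * (n : ℝ) + 8 - 6 * y k) : y 0 ≤ 1 := by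
  by_contra! h
  have grow : ∀ k, 2 ^ k * (y 0 - 1) ≤ y k - 1 := by
    intro k
    induction k with
    | zero => simp
    | succ k ih =>
      have h1 : 0 < 2 ^ k * (y 0 - 1) := mul_pos (by positivity) (sub_pos.2 h)
      have := two_mul_sub_one_le_ratioMap_sub_one (hd k) (by linarith)
      rw [hy, pow_succ]
      linarith
  have hlim : Tendsto (fun k : ℕ => (2 : ℝ) ^ k * (y 0 - 1)) atTop atTop :=
    (tendsto_pow_atTop_atTop_of_one_lt one_lt_two).atTop_mul_const (sub_pos.2 h)
  obtain ⟨k, hk⟩ := (hlim.eventually_ge_atTop (4 * (n : ℝ) + 8)).exists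
  have h0 : (0 : ℝ) ≤ n := n.cast_nonneg
  linarith [grow k, hd k]

/-- Every orbit of the ratio map starting in `(0, 1)` converges to the smaller fixed point. -/
lemma tendsto_orbit {n : ℕ} {y : ℕ → ℝ} (hy : ∀ k, y (k + 1) = ratioMap n (y k))
    (hpos : ∀ k, 0 < y k) (h1 : y 0 < 1) :
    Tendsto y atTop (𝓝 (1 / (2 * n + 3))) := by
  have h0 : (0 : ℝ) ≤ n := n.cast_nonneg
  set a : ℝ := 1 / (2 * n + 3) with ha
  have ha1 : a < 1 := by rw [ha, div_lt_one (by positivity)]; linarith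
  have ha0 : 0 < a := by positivity
  set M := max (y 0) a with hM
  have hM1 : M < 1 := max_lt h1 ha1
  have hM0 : 0 < M := ha0.trans_le (le_max_right _ _)
  set q := (4 * n * M + 2) / (4 * n + 8 - 6 * M) with hq
  have hdM : 0 < 4 * (n : ℝ) + 8 - 6 * M := by linarith
  have hq0 : 0 ≤ q := by positivity
  have hq1 : q < 1 := by
    rw [hq, div_lt_one hdM]
    nlinarith
  have hfactor : ∀ u, 0 < u → u ≤ M →
      0 ≤ (4 * n * u + 2) / (4 * n + 8 - 6 * u) ∧
        (4 * n * u + 2) / (4 * n + 8 - 6 * u) ≤ q := by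
    intro u hu huM
    have hd : 0 < 4 * (n : ℝ) + 8 - 6 * u := by linarith
    refine ⟨by positivity, ?_⟩
    rw [hq]
    gcongr
  have key : ∀ k, y k ≤ M ∧ |y k - a| ≤ q ^ k * |y 0 - a| := by
    intro k
    induction k with
    | zero => simp [hM]
    | succ k ih =>
      obtain ⟨hk, hka⟩ := ih
      obtain ⟨hc0, hcq⟩ := hfactor _ (hpos k) hk
      have hstep := ratioMap_sub_fixedPoint (n := n) (u := y k) (by linarith)
      rw [← hy, ← ha] at hstep
      set c := (4 * n * y k + 2) / (4 * n + 8 - 6 * y k)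
      constructor
      · have haM : a ≤ M := le_max_right _ _
        have : c * (y k - a) ≤ c * (M - a) := by gcongr
        have : c * (M - a) ≤ 1 * (M - a) :=
          mul_le_mul_of_nonneg_right (hcq.trans hq1.le) (sub_nonneg.2 haM)
        linarith
      · rw [hstep, abs_mul, abs_of_nonneg hc0, pow_succ', mul_assoc]
        gcongr
  have hlim : Tendsto (fun k : ℕ => q ^ k * |y 0 - a|) atTop (𝓝 0) := by
    simpa using (tendsto_pow_atTop_nhds_zero_of_lt_one hq0 hq1).mul_const |y 0 - a|
  exact tendsto_iff_norm_sub_tendsto_zero.2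
    (squeeze_zero (fun _ => norm_nonneg _) (fun k => (key k).2) hlim)

lemma RicHP_mem {n : ℕ} (hn : 1 ≤ n) {p : ℝ × ℝ} (hp : (0 < p.1 ∧ 0 < p.2) ∧ p.1 / p.2 ≤ 1) :
    (0 < (RicHP n p).1 ∧ 0 < (RicHP n p).2) ∧ (RicHP n p).1 / (RicHP n p).2 ≤ 1 := by
  obtain ⟨⟨h1, h2⟩, hu⟩ := hp
  have hn' : (1 : ℝ) ≤ n := by exact_mod_cast hn
  have hu0 : 0 < p.1 / p.2 := div_pos h1 h2
  have hd : 0 < 4 * (n : ℝ) + 8 - 6 * (p.1 / p.2) := by linarith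
  refine ⟨?_, ?_⟩
  · rw [RicHP_eq]
    exact ⟨by positivity, hd⟩
  · rw [RicHP_ratio, ← sub_nonpos, ratioMap_sub_one hd]
    exact div_nonpos_of_nonpos_of_nonneg
      (mul_nonpos_of_nonpos_of_nonneg (by linarith) (by positivity)) hd.le

lemma exists_ancient_iteration {n : ℕ} (hn : 1 ≤ n) {p : ℝ × ℝ} (hp : 0 < p.1 ∧ 0 < p.2)
    (hu : p.1 / p.2 ≤ 1) :
    ∃ x : ℤ → ℝ × ℝ, (∀ i ≤ (1 : ℤ), 0 < (x i).1 ∧ 0 < (x i).2) ∧ x 1 = p ∧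
      ∀ i ≤ (1 : ℤ), x (i - 1) = RicHP n (x i) := by
  have key : ∀ k : ℕ, (0 < ((RicHP n)^[k] p).1 ∧ 0 < ((RicHP n)^[k] p).2) ∧
      ((RicHP n)^[k] p).1 / ((RicHP n)^[k] p).2 ≤ 1 := by
    intro k
    induction k with
    | zero => exact ⟨hp, hu⟩
    | succ k ih =>
      rw [Function.iterate_succ_apply']
      exact RicHP_mem hn ih
  refine ⟨fun i => (RicHP n)^[(1 - i).toNat] p, fun i _ => (key _).1, by simp, fun i hi => ?_⟩
  have : (1 - (i - 1)).toNat = (1 - i).toNat + 1 := by omega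
  simp only [this, Function.iterate_succ_apply']

/-- The ratios along an ancient Ricci iteration form an orbit of the ratio map. -/
lemma ratio_orbit {n : ℕ} {x : ℤ → ℝ × ℝ} (hx : ∀ i ≤ (1 : ℤ), x (i - 1) = RicHP n (x i))
    (k : ℕ) :
    (x (1 - (k + 1 : ℕ))).1 / (x (1 - (k + 1 : ℕ))).2 =
      ratioMap n ((x (1 - (k : ℕ))).1 / (x (1 - (k : ℕ))).2) := by
  have h : (1 : ℤ) - (k + 1 : ℕ) = 1 - (k : ℕ) - 1 := by push_cast; ring
  rw [h, hx _ (by omega), RicHP_ratio]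

lemma tendsto_ancient_iteration {n : ℕ} {x : ℤ → ℝ × ℝ}
    (hpos : ∀ i ≤ (1 : ℤ), 0 < (x i).1 ∧ 0 < (x i).2)
    (hx : ∀ i ≤ (1 : ℤ), x (i - 1) = RicHP n (x i)) (h1 : (x 1).1 / (x 1).2 < 1) :
    Tendsto x atBot (𝓝 (((8 * n ^ 2 + 28 * n + 18) / (2 * n + 3) ^ 2 : ℝ),
      ((8 * n ^ 2 + 28 * n + 18) / (2 * n + 3) : ℝ))) := by
  have hlim := tendsto_orbit (y := fun k : ℕ => (x (1 - (k : ℕ))).1 / (x (1 - (k : ℕ))).2)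
    (ratio_orbit hx) (fun k => div_pos (hpos _ (by omega)).1 (hpos _ (by omega)).2)
    (by simpa using h1)
  have hcont : Continuous fun u : ℝ => ((2 + 4 * n * u ^ 2 : ℝ), (4 * n + 8 - 6 * u : ℝ)) := by
    fun_prop
  have hlim' := (hcont.tendsto _).comp hlim
  have hidx : Tendsto (fun i : ℤ => (-i).toNat) atBot atTop :=
    tendsto_atTop.2 fun b => (eventually_le_atBot (-(b : ℤ))).mono fun i hi => by omega
  have hpt : ((2 + 4 * n * (1 / (2 * n + 3)) ^ 2 : ℝ), (4 * n + 8 - 6 * (1 / (2 * n + 3)) : ℝ)) =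
      (((8 * n ^ 2 + 28 * n + 18) / (2 * n + 3) ^ 2 : ℝ),
        ((8 * n ^ 2 + 28 * n + 18) / (2 * n + 3) : ℝ)) := by
    have h3 : (2 * n + 3 : ℝ) ≠ 0 := by positivity
    ext
    · field_simp
      ring
    · field_simp
      ring
  rw [← hpt]
  refine (hlim'.comp hidx).congr' ?_
  filter_upwards [eventually_le_atBot (0 : ℤ)] with i hi
  have h : (1 : ℤ) - ((-i).toNat : ℕ) = i + 1 := by omega
  have hstep := hx (i + 1) (by omega)
  rw [add_sub_cancel_right] at hstep
  simp only [Function.comp_apply, h]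
  rw [hstep, RicHP_eq]

theorem stmt_3 (n : ℕ) (hn : 1 ≤ n) (t s : ℝ) (ht : 0 < t) (hs : 0 < s) :
    ((∃ x : ℤ → ℝ × ℝ,
        (∀ i ≤ (1 : ℤ), 0 < (x i).1 ∧ 0 < (x i).2) ∧ x 1 = (t, s) ∧
        ∀ i ≤ (1 : ℤ), x (i - 1) = RicHP n (x i)) ↔ t / s ≤ 1) ∧
    (t / s < 1 → ∀ x : ℤ → ℝ × ℝ,
        (∀ i ≤ (1 : ℤ), 0 < (x i).1 ∧ 0 < (x i).2) → x 1 = (t, s) →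
        (∀ i ≤ (1 : ℤ), x (i - 1) = RicHP n (x i)) →
        Tendsto x atBot
          (𝓝 (((8 * n ^ 2 + 28 * n + 18) / (2 * n + 3) ^ 2 : ℝ),
              ((8 * n ^ 2 + 28 * n + 18) / (2 * n + 3) : ℝ)))) := by
  refine ⟨⟨?_, exists_ancient_iteration (p := (t, s)) hn ⟨ht, hs⟩⟩, ?_⟩
  · rintro ⟨x, hpos, h1, hx⟩
    have := orbit_start_le_one (y := fun k : ℕ => (x (1 - (k : ℕ))).1 / (x (1 - (k : ℕ))).2)
      (ratio_orbit hx) fun k => by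
        have h := (hpos (1 - (k : ℕ) - 1) (by omega)).2
        rwa [hx _ (by omega), RicHP_eq] at h
    simpa [h1] using this
  · intro hu x hpos h1 hx
    exact tendsto_ancient_iteration hpos hx (by simpa [h1] using hu)
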